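/- The positive 3-forms on a 7-dimensional oriented real vector space form a single orbit of the orientation-preserving general linear group: if φ is a 3-form on ℝ × ℂ³ such that for every nonzero u the 7-form (i_uφ)∧(i_uφ)∧φ is a strictly positive multiple of the standard orientation form dt∧dx₁∧dy₁∧dx₂∧dy₂∧dx₃∧dy₃, then there exists an ℝ-linear automorphism g of ℝ × ℂ³ with positive determinant such that φ(x,y,z) = φ₀(g x, g y, g z) for all x,y,z. -/

import Mathlib

/-- The complex determinant of three vectors in `ℂ³`, as an `ℝ`-alternating map. -/
noncomputable def cDet : (Fin 3 → ℂ) [⋀^Fin 3]→ₗ[ℝ] ℂ :=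
  { toMultilinearMap :=
      MultilinearMap.restrictScalars ℝ
        (Matrix.detRowAlternating (R := ℂ) (n := Fin 3)).toMultilinearMap
    map_eq_zero_of_eq' := fun v _ _ hv hij =>
      (Matrix.detRowAlternating (R := ℂ) (n := Fin 3)).map_eq_zero_of_eq v hv hij }

/-- The standard model 3-form `ρ₀ = Re (dz₁ ∧ dz₂ ∧ dz₃)` on `ℂ³`. -/
noncomputable def rhoZero : (Fin 3 → ℂ) [⋀^Fin 3]→ₗ[ℝ] ℝ :=
  Complex.reLm.compAlternatingMap cDet

/-- The coordinates `(x_j, y_j, t)` on `ℝ × ℂ³`, used to express the decomposable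
3-form `dx_j ∧ dy_j ∧ dt` as a pulled-back determinant. -/
noncomputable def tripCoords (j : Fin 3) : (ℝ × (Fin 3 → ℂ)) →ₗ[ℝ] (Fin 3 → ℝ) :=
  LinearMap.pi fun i : Fin 3 =>
    if i.val = 0 then
      Complex.reLm.comp ((LinearMap.proj (R := ℝ) j).comp (LinearMap.snd ℝ ℝ (Fin 3 → ℂ)))
    else if i.val = 1 then
      Complex.imLm.comp ((LinearMap.proj (R := ℝ) j).comp (LinearMap.snd ℝ ℝ (Fin 3 → ℂ)))
    else LinearMap.fst ℝ ℝ (Fin 3 → ℂ)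

/-- The standard model 3-form `φ₀ = ω₀ ∧ dt + ρ₀` on `ℝ × ℂ³`, where
`ω₀ ∧ dt = Σⱼ dxⱼ ∧ dyⱼ ∧ dt`. -/
noncomputable def phiZero : (ℝ × (Fin 3 → ℂ)) [⋀^Fin 3]→ₗ[ℝ] ℝ :=
  (∑ j : Fin 3,
    (Matrix.detRowAlternating (R := ℝ) (n := Fin 3)).compLinearMap (tripCoords j))
  + rhoZero.compLinearMap (LinearMap.snd ℝ ℝ (Fin 3 → ℂ))

/-- The wedge product of real-valued alternating forms. -/
noncomputable def wedge {V : Type*} [AddCommGroup V] [Module ℝ V] {m n : ℕ}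
    (a : V [⋀^Fin m]→ₗ[ℝ] ℝ) (b : V [⋀^Fin n]→ₗ[ℝ] ℝ) : V [⋀^Fin (m + n)]→ₗ[ℝ] ℝ :=
  AlternatingMap.domDomCongr finSumFinEquiv
    ((LinearMap.mul' ℝ ℝ).compAlternatingMap (a.domCoprod b))

/-- The real coordinates `(t, x₁, y₁, x₂, y₂, x₃, y₃)` on `ℝ × ℂ³`. -/
noncomputable def realCoords7 : (ℝ × (Fin 3 → ℂ)) →ₗ[ℝ] (Fin 7 → ℝ) :=
  LinearMap.pi fun i : Fin 7 =>
    if i.val = 0 then LinearMap.fst ℝ ℝ (Fin 3 → ℂ)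
    else
      ((if (i.val - 1) % 2 = 0 then Complex.reLm else Complex.imLm).comp
        ((LinearMap.proj (R := ℝ) (⟨(i.val - 1) / 2, by have := i.isLt; omega⟩ : Fin 3)).comp
          (LinearMap.snd ℝ ℝ (Fin 3 → ℂ))))

/-- The standard orientation form `dt ∧ dx₁ ∧ dy₁ ∧ dx₂ ∧ dy₂ ∧ dx₃ ∧ dy₃` on `ℝ × ℂ³`. -/
noncomputable def orientZero : (ℝ × (Fin 3 → ℂ)) [⋀^Fin 7]→ₗ[ℝ] ℝ :=
  (Matrix.detRowAlternating (R := ℝ) (n := Fin 7)).compLinearMap realCoords7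

/-- A 3-form `φ` on `ℝ × ℂ³` is *positive* if for every nonzero `u` the 7-form
`(i_u φ) ∧ (i_u φ) ∧ φ` is a strictly positive multiple of the standard
orientation form. -/
noncomputable def IsPositive3Form (φ : (ℝ × (Fin 3 → ℂ)) [⋀^Fin 3]→ₗ[ℝ] ℝ) : Prop :=
  ∀ u : ℝ × (Fin 3 → ℂ), u ≠ 0 → ∃ c : ℝ, 0 < c ∧
    wedge (wedge (φ.curryLeft u) (φ.curryLeft u)) φ = c • orientZero

open Equiv in
theorem wedge_apply_smul {V : Type*} [AddCommGroup V] [Module ℝ V] {m n : ℕ}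
    (a : V [⋀^Fin m]→ₗ[ℝ] ℝ) (b : V [⋀^Fin n]→ₗ[ℝ] ℝ) (v : Fin (m + n) → V) :
    (m.factorial * n.factorial : ℝ) * wedge a b v =
      ∑ σ : Perm (Fin (m + n)), ((Perm.sign σ : ℤ) : ℝ) *
        (a (fun i => v (σ (Fin.castAdd n i))) * b (fun i => v (σ (Fin.natAdd m i)))) := by
  have h := congrArg (fun f => LinearMap.mul' ℝ ℝ (f (v ∘ finSumFinEquiv)))
    (MultilinearMap.domCoprod_alternization_eq a b)
  simp only [MultilinearMap.alternatization_apply, Fintype.card_fin, AlternatingMap.smul_apply,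
    map_sum, map_nsmul] at h
  have hw : wedge a b v = LinearMap.mul' ℝ ℝ ((a.domCoprod b) (v ∘ finSumFinEquiv)) := rfl
  rw [hw, ← Nat.cast_mul, ← nsmul_eq_mul, ← h,
    ← (finSumFinEquiv (m := m) (n := n)).permCongr.sum_comp]
  refine Finset.sum_congr rfl fun σ _ => ?_
  simp only [Units.smul_def, zsmul_eq_mul]
  simp [← zsmul_eq_mul, Function.comp_def]

open Equiv in
/-- Expansion of an alternating sum according to the slot that receives the first vector. -/
theorem sum_perm_fin_succ {V : Type*} {n : ℕ} (F : (Fin (n + 1) → V) → ℝ) (v : Fin (n + 1) → V) :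
    ∑ σ : Perm (Fin (n + 1)), ((Perm.sign σ : ℤ) : ℝ) * F (fun i => v (σ i)) =
      ∑ p : Fin (n + 1), (-1) ^ (p : ℕ) * ∑ τ : Perm (Fin n), ((Perm.sign τ : ℤ) : ℝ) *
        F (p.insertNth (v 0) fun i => v (τ i).succ) := by
  simp_rw [Finset.mul_sum]
  rw [← Fintype.sum_prod_type']
  have h0 : ∀ τ : Perm (Fin n), (Perm.decomposeFin.symm (0, τ)).symm 0 = 0 := fun τ => by
    rw [Equiv.symm_apply_eq, Perm.decomposeFin_symm_apply_zero]
  refine (Fintype.sum_bijective (fun x : Fin (n + 1) × Perm (Fin n) =>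
    Perm.decomposeFin.symm (0, x.2) * x.1.cycleRange) ?_ _ _ ?_).symm
  · rw [Fintype.bijective_iff_injective_and_card]
    refine ⟨?_, by simp [Fintype.card_perm, Nat.factorial_succ]⟩
    rintro ⟨p, τ⟩ ⟨q, ρ⟩ h
    have hpq : p = q := by
      have := congrArg (fun σ : Perm (Fin (n + 1)) => σ.symm 0) h
      simpa [Perm.mul_def, h0, Fin.cycleRange_symm_zero] using this
    subst hpq
    simpa using mul_right_cancel h
  · rintro ⟨p, τ⟩
    have : (fun i => v ((Perm.decomposeFin.symm (0, τ) * p.cycleRange) i)) =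
        p.insertNth (v 0) fun i => v (τ i).succ := by
      funext i
      induction i using Fin.succAboveCases p <;> simp
    rw [this]
    simp [Fin.sign_cycleRange, mul_assoc, mul_left_comm]

/-- The Pfaffian of an alternating pairing on four vectors. -/
def pfaff {V : Type*} (a : V → V → ℝ) (x y z w : V) : ℝ :=
  a x y * a z w - a x z * a y w + a x w * a y z

theorem sum_perm_two {V : Type*} (F : V → V → ℝ) (v : Fin 2 → V) :
    ∑ σ : Equiv.Perm (Fin 2), ((Equiv.Perm.sign σ : ℤ) : ℝ) * F (v (σ 0)) (v (σ 1)) =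
      F (v 0) (v 1) - F (v 1) (v 0) := by
  rw [sum_perm_fin_succ (fun x : Fin 2 → V => F (x 0) (x 1)) v]
  simp [Fin.insertNth, Fin.succAboveCases, sub_eq_add_neg]

theorem sum_perm_three {V : Type*} (F : V → V → V → ℝ) (v : Fin 3 → V) :
    ∑ σ : Equiv.Perm (Fin 3), ((Equiv.Perm.sign σ : ℤ) : ℝ) *
        F (v (σ 0)) (v (σ 1)) (v (σ 2)) =
      F (v 0) (v 1) (v 2) - F (v 0) (v 2) (v 1) - F (v 1) (v 0) (v 2) + F (v 2) (v 0) (v 1)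
        + F (v 1) (v 2) (v 0) - F (v 2) (v 1) (v 0) := by
  rw [sum_perm_fin_succ (fun x : Fin 3 → V => F (x 0) (x 1) (x 2)) v, Fin.sum_univ_three]
  have h0 := sum_perm_two (fun x y => F (v 0) x y) (fun i => v i.succ)
  have h1 := sum_perm_two (fun x y => F x (v 0) y) (fun i => v i.succ)
  have h2 := sum_perm_two (fun x y => F x y (v 0)) (fun i => v i.succ)
  simp [Fin.insertNth, Fin.succAboveCases, Fin.castPred, Fin.castLT] at h0 h1 h2 ⊢
  rw [h0, h1, h2]
  ring

theorem sum_perm_four {V : Type*} (F : V → V → V → V → ℝ) (v : Fin 4 → V) :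
    ∑ σ : Equiv.Perm (Fin 4), ((Equiv.Perm.sign σ : ℤ) : ℝ) *
        F (v (σ 0)) (v (σ 1)) (v (σ 2)) (v (σ 3)) =
      ∑ τ : Equiv.Perm (Fin 3), ((Equiv.Perm.sign τ : ℤ) : ℝ) *
        (F (v 0) (v (τ 0).succ) (v (τ 1).succ) (v (τ 2).succ)
          - F (v (τ 0).succ) (v 0) (v (τ 1).succ) (v (τ 2).succ)
          + F (v (τ 0).succ) (v (τ 1).succ) (v 0) (v (τ 2).succ)
          - F (v (τ 0).succ) (v (τ 1).succ) (v (τ 2).succ) (v 0)) := by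
  rw [sum_perm_fin_succ (fun x : Fin 4 → V => F (x 0) (x 1) (x 2) (x 3)) v]
  simp_rw [Finset.mul_sum]
  rw [Finset.sum_comm]
  refine Finset.sum_congr rfl fun τ _ => ?_
  rw [Fin.sum_univ_four]
  simp [Fin.insertNth, Fin.succAboveCases, Fin.castPred, Fin.castLT]
  ring

theorem sum_perm_five {V : Type*} (F : V → V → V → V → V → ℝ) (v : Fin 5 → V) :
    ∑ σ : Equiv.Perm (Fin 5), ((Equiv.Perm.sign σ : ℤ) : ℝ) *
        F (v (σ 0)) (v (σ 1)) (v (σ 2)) (v (σ 3)) (v (σ 4)) =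
      ∑ τ : Equiv.Perm (Fin 4), ((Equiv.Perm.sign τ : ℤ) : ℝ) *
        (F (v 0) (v (τ 0).succ) (v (τ 1).succ) (v (τ 2).succ) (v (τ 3).succ)
          - F (v (τ 0).succ) (v 0) (v (τ 1).succ) (v (τ 2).succ) (v (τ 3).succ)
          + F (v (τ 0).succ) (v (τ 1).succ) (v 0) (v (τ 2).succ) (v (τ 3).succ)
          - F (v (τ 0).succ) (v (τ 1).succ) (v (τ 2).succ) (v 0) (v (τ 3).succ)
          + F (v (τ 0).succ) (v (τ 1).succ) (v (τ 2).succ) (v (τ 3).succ) (v 0)) := by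
  rw [sum_perm_fin_succ (fun x : Fin 5 → V => F (x 0) (x 1) (x 2) (x 3) (x 4)) v]
  simp_rw [Finset.mul_sum]
  rw [Finset.sum_comm]
  refine Finset.sum_congr rfl fun τ _ => ?_
  rw [Fin.sum_univ_five]
  simp [Fin.insertNth, Fin.succAboveCases, Fin.castPred, Fin.castLT]
  ring

theorem sum_perm_six {V : Type*} (F : V → V → V → V → V → V → ℝ) (v : Fin 6 → V) :
    ∑ σ : Equiv.Perm (Fin 6), ((Equiv.Perm.sign σ : ℤ) : ℝ) *
        F (v (σ 0)) (v (σ 1)) (v (σ 2)) (v (σ 3)) (v (σ 4)) (v (σ 5)) =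
      ∑ τ : Equiv.Perm (Fin 5), ((Equiv.Perm.sign τ : ℤ) : ℝ) *
        (F (v 0) (v (τ 0).succ) (v (τ 1).succ) (v (τ 2).succ) (v (τ 3).succ) (v (τ 4).succ)
          - F (v (τ 0).succ) (v 0) (v (τ 1).succ) (v (τ 2).succ) (v (τ 3).succ) (v (τ 4).succ)
          + F (v (τ 0).succ) (v (τ 1).succ) (v 0) (v (τ 2).succ) (v (τ 3).succ) (v (τ 4).succ)
          - F (v (τ 0).succ) (v (τ 1).succ) (v (τ 2).succ) (v 0) (v (τ 3).succ) (v (τ 4).succ)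
          + F (v (τ 0).succ) (v (τ 1).succ) (v (τ 2).succ) (v (τ 3).succ) (v 0) (v (τ 4).succ)
          - F (v (τ 0).succ) (v (τ 1).succ) (v (τ 2).succ) (v (τ 3).succ) (v (τ 4).succ) (v 0)) := by
  rw [sum_perm_fin_succ (fun x : Fin 6 → V => F (x 0) (x 1) (x 2) (x 3) (x 4) (x 5)) v]
  simp_rw [Finset.mul_sum]
  rw [Finset.sum_comm]
  refine Finset.sum_congr rfl fun τ _ => ?_
  rw [Fin.sum_univ_six]
  simp [Fin.insertNth, Fin.succAboveCases, Fin.castPred, Fin.castLT]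
  ring

theorem sum_perm_seven {V : Type*} (F : V → V → V → V → V → V → V → ℝ) (v : Fin 7 → V) :
    ∑ σ : Equiv.Perm (Fin 7), ((Equiv.Perm.sign σ : ℤ) : ℝ) *
        F (v (σ 0)) (v (σ 1)) (v (σ 2)) (v (σ 3)) (v (σ 4)) (v (σ 5)) (v (σ 6)) =
      ∑ τ : Equiv.Perm (Fin 6), ((Equiv.Perm.sign τ : ℤ) : ℝ) *
        (F (v 0) (v (τ 0).succ) (v (τ 1).succ) (v (τ 2).succ) (v (τ 3).succ) (v (τ 4).succ) (v (τ 5).succ)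
          - F (v (τ 0).succ) (v 0) (v (τ 1).succ) (v (τ 2).succ) (v (τ 3).succ) (v (τ 4).succ) (v (τ 5).succ)
          + F (v (τ 0).succ) (v (τ 1).succ) (v 0) (v (τ 2).succ) (v (τ 3).succ) (v (τ 4).succ) (v (τ 5).succ)
          - F (v (τ 0).succ) (v (τ 1).succ) (v (τ 2).succ) (v 0) (v (τ 3).succ) (v (τ 4).succ) (v (τ 5).succ)
          + F (v (τ 0).succ) (v (τ 1).succ) (v (τ 2).succ) (v (τ 3).succ) (v 0) (v (τ 4).succ) (v (τ 5).succ)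
          - F (v (τ 0).succ) (v (τ 1).succ) (v (τ 2).succ) (v (τ 3).succ) (v (τ 4).succ) (v 0) (v (τ 5).succ)
          + F (v (τ 0).succ) (v (τ 1).succ) (v (τ 2).succ) (v (τ 3).succ) (v (τ 4).succ) (v (τ 5).succ) (v 0)) := by
  rw [sum_perm_fin_succ (fun x : Fin 7 → V => F (x 0) (x 1) (x 2) (x 3) (x 4) (x 5) (x 6)) v]
  simp_rw [Finset.mul_sum]
  rw [Finset.sum_comm]
  refine Finset.sum_congr rfl fun τ _ => ?_
  rw [Fin.sum_univ_seven]
  simp [Fin.insertNth, Fin.succAboveCases, Fin.castPred, Fin.castLT]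
  ring


theorem sum_perm_four_mul {V : Type*} (A : V → V → ℝ) (hA : ∀ x y, A y x = -A x y)
    (v : Fin 4 → V) :
    ∑ σ : Equiv.Perm (Fin 4), ((Equiv.Perm.sign σ : ℤ) : ℝ) *
        (A (v (σ 0)) (v (σ 1)) * A (v (σ 2)) (v (σ 3))) =
      8 * pfaff A (v 0) (v 1) (v 2) (v 3) := by
  rw [sum_perm_four (fun x y z w => A x y * A z w) v]
  rw [sum_perm_three (fun x y z => A (v 0) x * A y z - A x (v 0) * A y z + A x y * A (v 0) z
    - A x y * A z (v 0)) (fun i => v i.succ)]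
  simp only [Fin.succ_zero_eq_one, Fin.succ_one_eq_two, Fin.reduceSucc, hA (v 0) (v 1),
    hA (v 0) (v 2), hA (v 0) (v 3), hA (v 1) (v 2), hA (v 1) (v 3), hA (v 2) (v 3), pfaff]
  ring

theorem sum_perm_four_pfaff {V : Type*} (A : V → V → ℝ) (hA : ∀ x y, A y x = -A x y)
    (v : Fin 4 → V) :
    ∑ σ : Equiv.Perm (Fin 4), ((Equiv.Perm.sign σ : ℤ) : ℝ) *
        pfaff A (v (σ 0)) (v (σ 1)) (v (σ 2)) (v (σ 3)) =
      24 * pfaff A (v 0) (v 1) (v 2) (v 3) := by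
  rw [sum_perm_four (pfaff A) v]
  rw [sum_perm_three (fun x y z => pfaff A (v 0) x y z - pfaff A x (v 0) y z
    + pfaff A x y (v 0) z - pfaff A x y z (v 0)) (fun i => v i.succ)]
  simp only [Fin.succ_zero_eq_one, Fin.succ_one_eq_two, Fin.reduceSucc, hA (v 0) (v 1),
    hA (v 0) (v 2), hA (v 0) (v 3), hA (v 1) (v 2), hA (v 1) (v 3), hA (v 2) (v 3), pfaff]
  ring

theorem map_swap_left {V : Type*} [AddCommGroup V] [Module ℝ V]
    (φ : V [⋀^Fin 3]→ₗ[ℝ] ℝ) (x y z : V) : φ ![y, x, z] = -φ ![x, y, z] := by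
  rw [← φ.map_swap ![x, y, z] (i := 0) (j := 1) (by decide)]
  congr 1
  funext i; fin_cases i <;> rfl

theorem map_swap_right {V : Type*} [AddCommGroup V] [Module ℝ V]
    (φ : V [⋀^Fin 3]→ₗ[ℝ] ℝ) (x y z : V) : φ ![x, z, y] = -φ ![x, y, z] := by
  rw [← φ.map_swap ![x, y, z] (i := 1) (j := 2) (by decide)]
  congr 1
  funext i; fin_cases i <;> rfl

theorem map_swap_two {V : Type*} [AddCommGroup V] [Module ℝ V]
    (a : V [⋀^Fin 2]→ₗ[ℝ] ℝ) (x y : V) : a ![y, x] = -a ![x, y] := by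
  rw [← a.map_swap ![x, y] (i := 0) (j := 1) (by decide)]
  congr 1
  funext i; fin_cases i <;> rfl

theorem wedge_self_apply {V : Type*} [AddCommGroup V] [Module ℝ V]
    (a : V [⋀^Fin 2]→ₗ[ℝ] ℝ) (v : Fin 4 → V) :
    wedge a a v = 2 * pfaff (fun x y => a ![x, y]) (v 0) (v 1) (v 2) (v 3) := by
  have h := wedge_apply_smul a a v
  have h2 := sum_perm_four_mul (fun x y => a ![x, y]) (map_swap_two a) v
  have e : ∀ σ : Equiv.Perm (Fin 4),
    a (fun i => v (σ (Fin.castAdd 2 i))) * a (fun i => v (σ (Fin.natAdd 2 i))) =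
    a ![v (σ 0), v (σ 1)] * a ![v (σ 2), v (σ 3)] := by
    intro σ
    congr 2 <;> (funext i; fin_cases i <;> rfl)
  simp only [e, h2] at h
  norm_num [Nat.factorial] at h
  linarith

theorem wedge_wedge_self_apply {V : Type*} [AddCommGroup V] [Module ℝ V]
    (a : V [⋀^Fin 2]→ₗ[ℝ] ℝ) (φ : V [⋀^Fin 3]→ₗ[ℝ] ℝ) (v : Fin 7 → V) :
    72 * wedge (wedge a a) φ v =
      ∑ σ : Equiv.Perm (Fin 7), ((Equiv.Perm.sign σ : ℤ) : ℝ) *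
        (pfaff (fun x y => a ![x, y]) (v (σ 0)) (v (σ 1)) (v (σ 2)) (v (σ 3)) *
          φ ![v (σ 4), v (σ 5), v (σ 6)]) := by
  have h := wedge_apply_smul (wedge a a) φ v
  have e : ∀ σ : Equiv.Perm (Fin 7), φ (fun i => v (σ (Fin.natAdd 4 i))) =
      φ ![v (σ 4), v (σ 5), v (σ 6)] := by
    intro σ
    congr 1
    funext i; fin_cases i <;> rfl
  simp only [wedge_self_apply, e] at h
  have e2 : ∀ σ : Equiv.Perm (Fin 7), ((Equiv.Perm.sign σ : ℤ) : ℝ) *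
      (2 * pfaff (fun x y => a ![x, y]) (v (σ 0)) (v (σ 1)) (v (σ 2)) (v (σ 3)) *
          φ ![v (σ 4), v (σ 5), v (σ 6)]) = 2 * (((Equiv.Perm.sign σ : ℤ) : ℝ) *
      (pfaff (fun x y => a ![x, y]) (v (σ 0)) (v (σ 1)) (v (σ 2)) (v (σ 3)) *
          φ ![v (σ 4), v (σ 5), v (σ 6)])) := fun σ => by ring
  have h' := h.trans (Finset.sum_congr rfl fun σ _ => e2 σ)
  rw [← Finset.mul_sum] at h'
  norm_num [Nat.factorial] at h'
  linarith

/-- Wedge product against a flag adapted to the plane spanned by `v 0` and `v 1`. -/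
theorem wedge_contraction_apply {V : Type*} [AddCommGroup V] [Module ℝ V]
    (φ : V [⋀^Fin 3]→ₗ[ℝ] ℝ) (v : Fin 7 → V)
    (h : ∀ i : Fin 4, φ ![v 0, v 1, v i.succ.succ.succ] = 0) :
    wedge (wedge (φ.curryLeft (v 0)) (φ.curryLeft (v 0))) φ v =
      6 * (φ ![v 0, v 1, v 2] * pfaff (fun x y => φ ![v 0, x, y]) (v 3) (v 4) (v 5) (v 6)) := by
  have key := wedge_wedge_self_apply (φ.curryLeft (v 0)) φ v
  have hc : (fun x y => φ.curryLeft (v 0) ![x, y]) = fun x y => φ ![v 0, x, y] := by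
    funext x y; rfl
  rw [hc] at key
  have s12 := map_swap_left φ
  have s23 := map_swap_right φ
  set A : V → V → ℝ := fun x y => φ ![v 0, x, y] with hA
  have hAs : ∀ x y, A y x = -A x y := fun x y => s23 _ _ _
  have hA0 : ∀ x, A (v 0) x = 0 := fun x => by have := s12 (v 0) (v 0) x; simp only [hA]; linarith
  have hA0' : ∀ x, A x (v 0) = 0 := fun x => by rw [hAs, hA0, neg_zero]
  have e0 : ∀ x y, φ ![v 0, x, y] = A x y := fun x y => rfl
  have e1 : ∀ x y, φ ![x, v 0, y] = -A x y := fun x y => s12 _ _ _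
  have e2 : ∀ x y, φ ![x, y, v 0] = A x y := fun x y => by rw [s23, e1, neg_neg]
  have h1 : ∀ i : Fin 4, A (v 1) (v i.succ.succ.succ) = 0 := h
  have h1' : ∀ i : Fin 4, A (v i.succ.succ.succ) (v 1) = 0 := fun i => by rw [hAs, h1, neg_zero]
  have hA1 : A (v 1) (v 1) = 0 := by linarith [hAs (v 1) (v 1)]
  rw [sum_perm_seven (fun x y z w p q r => pfaff A x y z w * φ ![p, q, r]) v] at key
  have hp : ∀ x y z, pfaff A (v 0) x y z = 0 ∧ pfaff A x (v 0) y z = 0 ∧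
      pfaff A x y (v 0) z = 0 ∧ pfaff A x y z (v 0) = 0 := fun x y z => by
    simp [pfaff, hA0, hA0']
  simp only [fun x y z => (hp x y z).1, fun x y z => (hp x y z).2.1, fun x y z => (hp x y z).2.2.1,
    fun x y z => (hp x y z).2.2.2, e0, e1, e2] at key
  have key2 := key.trans (Finset.sum_congr rfl fun τ _ =>
    show _ = 3 * (((Equiv.Perm.sign τ : ℤ) : ℝ) *
      (pfaff A (v (τ 0).succ) (v (τ 1).succ) (v (τ 2).succ) (v (τ 3).succ) *
        A (v (τ 4).succ) (v (τ 5).succ))) by ring)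
  rw [← Finset.mul_sum, sum_perm_six (fun x y z w p q => pfaff A x y z w * A p q)
    (fun i => v i.succ)] at key2
  simp only [Fin.succ_zero_eq_one] at key2
  rw [sum_perm_five (fun x y z w p => pfaff A (v 1) x y z * A w p - pfaff A x (v 1) y z * A w p
    + pfaff A x y (v 1) z * A w p - pfaff A x y z (v 1) * A w p
    + pfaff A x y z w * A (v 1) p - pfaff A x y z w * A p (v 1)) (fun i => v i.succ.succ)] at key2
  simp only [Fin.succ_zero_eq_one, Fin.succ_one_eq_two] at key2
  have key3 := key2.trans (congrArg (3 * ·) (Finset.sum_congr rfl fun τ _ =>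
    show _ = A (v 1) (v 2) * (2 * (((Equiv.Perm.sign τ : ℤ) : ℝ) *
      pfaff A (v (τ 0).succ.succ.succ) (v (τ 1).succ.succ.succ) (v (τ 2).succ.succ.succ)
        (v (τ 3).succ.succ.succ)) + 12 * (((Equiv.Perm.sign τ : ℤ) : ℝ) *
      (A (v (τ 0).succ.succ.succ) (v (τ 1).succ.succ.succ) *
      A (v (τ 2).succ.succ.succ) (v (τ 3).succ.succ.succ)))) by
        simp only [pfaff, h1, h1', hAs (v 1) (v 2)]; ring))
  simp only [← Finset.mul_sum, Finset.sum_add_distrib] at key3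
  rw [sum_perm_four_mul A hAs (fun i => v i.succ.succ.succ),
    sum_perm_four_pfaff A hAs (fun i => v i.succ.succ.succ)] at key3
  simp only [Fin.succ_zero_eq_one, Fin.succ_one_eq_two, Fin.reduceSucc] at key3
  rw [e0]
  linarith

section Frames

variable {V : Type*} [AddCommGroup V] [Module ℝ V] (φ : V [⋀^Fin 3]→ₗ[ℝ] ℝ)

theorem map_add_first (x x' y z : V) : φ ![x + x', y, z] = φ ![x, y, z] + φ ![x', y, z] :=
  φ.toMultilinearMap.cons_add ![y, z] x x'

theorem map_smul_first (r : ℝ) (x y z : V) : φ ![r • x, y, z] = r * φ ![x, y, z] :=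
  φ.toMultilinearMap.cons_smul ![y, z] r x

theorem map_add_second (x y y' z : V) : φ ![x, y + y', z] = φ ![x, y, z] + φ ![x, y', z] := by
  simp only [map_swap_left φ _ x, map_add_first, neg_add]

theorem map_smul_second (r : ℝ) (x y z : V) : φ ![x, r • y, z] = r * φ ![x, y, z] := by
  simp only [map_swap_left φ _ x, map_smul_first, mul_neg]

theorem map_add_third (x y z z' : V) : φ ![x, y, z + z'] = φ ![x, y, z] + φ ![x, y, z'] := by
  simp only [map_swap_right φ x _ y, map_add_second, neg_add]

theorem map_smul_third (r : ℝ) (x y z : V) : φ ![x, y, r • z] = r * φ ![x, y, z] := by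
  simp only [map_swap_right φ x _ y, map_smul_second, mul_neg]

theorem map_eq_zero_left (x y : V) : φ ![x, x, y] = 0 := by
  linarith [map_swap_left φ x x y]

theorem map_eq_zero_right (x y : V) : φ ![x, y, y] = 0 := by
  linarith [map_swap_right φ x y y]

theorem map_eq_zero_outer (x y : V) : φ ![x, y, x] = 0 := by
  rw [map_swap_right, map_eq_zero_left, neg_zero]

theorem map_sort_left {n : ℕ} (f : Fin n → V) (z : V) {i j : Fin n} (_ : j < i) :
    φ ![f i, f j, z] = -φ ![f j, f i, z] :=
  map_swap_left φ _ _ _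

theorem map_sort_right {n : ℕ} (f : Fin n → V) (x : V) {i j : Fin n} (_ : j < i) :
    φ ![x, f i, f j] = -φ ![x, f j, f i] :=
  map_swap_right φ _ _ _

/-- The last five vectors of the frame are adapted to the plane spanned by the first two. -/
structure IsFlag (f : Fin 7 → V) : Prop where
  h012 : φ ![f 0, f 1, f 2] = 1
  h013 : φ ![f 0, f 1, f 3] = 0
  h014 : φ ![f 0, f 1, f 4] = 0
  h015 : φ ![f 0, f 1, f 5] = 0
  h016 : φ ![f 0, f 1, f 6] = 0

/-- A flag frame in which the first two contractions of the form are the real and imaginary part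
of the complex area form. -/
structure IsComplexFlag (f : Fin 7 → V) : Prop extends IsFlag φ f where
  h034 : φ ![f 0, f 3, f 4] = 0
  h035 : φ ![f 0, f 3, f 5] = 1
  h036 : φ ![f 0, f 3, f 6] = 0
  h045 : φ ![f 0, f 4, f 5] = 0
  h046 : φ ![f 0, f 4, f 6] = -1
  h056 : φ ![f 0, f 5, f 6] = 0
  h134 : φ ![f 1, f 3, f 4] = 0
  h135 : φ ![f 1, f 3, f 5] = 0
  h136 : φ ![f 1, f 3, f 6] = -1
  h145 : φ ![f 1, f 4, f 5] = -1
  h146 : φ ![f 1, f 4, f 6] = 0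
  h156 : φ ![f 1, f 5, f 6] = 0

/-- A complex flag frame without mixed terms. -/
structure IsSplitFlag (f : Fin 7 → V) : Prop extends IsComplexFlag φ f where
  h023 : φ ![f 0, f 2, f 3] = 0
  h024 : φ ![f 0, f 2, f 4] = 0
  h025 : φ ![f 0, f 2, f 5] = 0
  h026 : φ ![f 0, f 2, f 6] = 0
  h123 : φ ![f 1, f 2, f 3] = 0
  h124 : φ ![f 1, f 2, f 4] = 0
  h125 : φ ![f 1, f 2, f 5] = 0
  h126 : φ ![f 1, f 2, f 6] = 0
  h345 : φ ![f 3, f 4, f 5] = 0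
  h346 : φ ![f 3, f 4, f 6] = 0
  h356 : φ ![f 3, f 5, f 6] = 0
  h456 : φ ![f 4, f 5, f 6] = 0

/-- A split flag frame in which the third contraction is diagonal. -/
structure IsDiagonalFlag (f : Fin 7 → V) : Prop extends IsSplitFlag φ f where
  h235 : φ ![f 2, f 3, f 5] = 0
  h236 : φ ![f 2, f 3, f 6] = 0
  h245 : φ ![f 2, f 4, f 5] = 0
  h246 : φ ![f 2, f 4, f 6] = 0

variable {φ}

theorem IsFlag.linearIndependent {f : Fin 7 → V} (hf : IsFlag φ f)
    (hp : pfaff (fun x y => φ ![f 0, x, y]) (f 3) (f 4) (f 5) (f 6) ≠ 0) :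
    LinearIndependent ℝ f := by
  obtain ⟨h012, h013, h014, h015, h016⟩ := hf
  rw [Fintype.linearIndependent_iff]
  intro g hg
  rw [Fin.sum_univ_seven] at hg
  have hz : ∀ x y, φ ![x, y, 0] = 0 := fun x y => φ.map_coord_zero 2 rfl
  have key : ∀ x y, φ ![x, y, g 0 • f 0 + g 1 • f 1 + g 2 • f 2 + g 3 • f 3 + g 4 • f 4 + g 5 • f 5
      + g 6 • f 6] = 0 := fun x y => by rw [hg]; exact hz x y
  simp only [map_add_third, map_smul_third] at key
  have k01 := key (f 0) (f 1)
  have k03 := key (f 0) (f 3)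
  have k04 := key (f 0) (f 4)
  have k05 := key (f 0) (f 5)
  have k06 := key (f 0) (f 6)
  have k02 := key (f 0) (f 2)
  have k12 := key (f 1) (f 2)
  simp only [map_eq_zero_left, map_eq_zero_right, map_sort_left φ f,
    map_sort_right φ f, Fin.reduceLT, h012, h013, h014, h015, h016] at k01 k02 k12 k03 k04 k05 k06
  have g2 : g 2 = 0 := by linarith
  rw [g2] at k03 k04 k05 k06
  simp only [pfaff] at hp
  have g3 : g 3 = 0 := by
    refine (mul_eq_zero.1 ?_).resolve_right hp
    linear_combination -φ ![f 0, f 5, f 6] * k04 + φ ![f 0, f 4, f 6] * k05 - φ ![f 0, f 4, f 5] * k06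
  have g4 : g 4 = 0 := by
    refine (mul_eq_zero.1 ?_).resolve_right hp
    linear_combination φ ![f 0, f 5, f 6] * k03 - φ ![f 0, f 3, f 6] * k05 + φ ![f 0, f 3, f 5] * k06
  have g5 : g 5 = 0 := by
    refine (mul_eq_zero.1 ?_).resolve_right hp
    linear_combination -φ ![f 0, f 4, f 6] * k03 + φ ![f 0, f 3, f 6] * k04 - φ ![f 0, f 3, f 4] * k06
  have g6 : g 6 = 0 := by
    refine (mul_eq_zero.1 ?_).resolve_right hp
    linear_combination φ ![f 0, f 4, f 5] * k03 - φ ![f 0, f 3, f 5] * k04 + φ ![f 0, f 3, f 4] * k05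
  rw [g2, g3, g4, g5, g6] at k02 k12
  have g1 : g 1 = 0 := by linarith
  have g0 : g 0 = 0 := by linarith
  intro i
  fin_cases i <;> assumption

theorem IsComplexFlag.exists_isSplitFlag {f : Fin 7 → V} (hf : IsComplexFlag φ f) :
    ∃ f' : Fin 7 → V, IsSplitFlag φ f' := by
  obtain ⟨⟨h012, h013, h014, h015, h016⟩, h034, h035, h036, h045, h046, h056,
    h134, h135, h136, h145, h146, h156⟩ := hf
  obtain ⟨m1, hm1⟩ : ∃ m, m = (φ ![f 3, f 4, f 5] + φ ![f 0, f 2, f 3] + φ ![f 1, f 2, f 4]) / 2 :=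
    ⟨_, rfl⟩
  obtain ⟨l1, hl1⟩ : ∃ m, m = (φ ![f 3, f 4, f 6] + φ ![f 0, f 2, f 4] - φ ![f 1, f 2, f 3]) / 2 :=
    ⟨_, rfl⟩
  obtain ⟨y1, hy1⟩ : ∃ m, m = (φ ![f 1, f 2, f 6] - φ ![f 3, f 5, f 6] - φ ![f 0, f 2, f 5]) / 2 :=
    ⟨_, rfl⟩
  obtain ⟨m4, hm4⟩ : ∃ m, m = (φ ![f 4, f 5, f 6] + φ ![f 0, f 2, f 6] - φ ![f 1, f 2, f 5]) / 2 :=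
    ⟨_, rfl⟩
  refine ⟨![f 0, f 1, f 2 + y1 • f 3 + (φ ![f 0, f 2, f 6] - m4) • f 4
      + (φ ![f 0, f 2, f 3] - m1) • f 5 + (-φ ![f 1, f 2, f 3] - l1) • f 6,
    f 3 + l1 • f 0 + m1 • f 1,
    f 4 + (φ ![f 3, f 4, f 5] - m1) • f 0 + (l1 - φ ![f 3, f 4, f 6]) • f 1,
    f 5 + (m4 - φ ![f 4, f 5, f 6]) • f 0 + (y1 + φ ![f 0, f 2, f 5]) • f 1,
    f 6 + (y1 - φ ![f 1, f 2, f 6]) • f 0 + m4 • f 1], ⟨⟨⟨?_, ?_, ?_, ?_, ?_⟩,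
    ?_, ?_, ?_, ?_, ?_, ?_, ?_, ?_, ?_, ?_, ?_, ?_⟩, ?_, ?_, ?_, ?_, ?_, ?_, ?_, ?_, ?_, ?_, ?_, ?_⟩⟩
  all_goals
    simp only [Matrix.cons_val, map_add_first, map_smul_first, map_add_second, map_smul_second,
      map_add_third, map_smul_third, map_eq_zero_left, map_eq_zero_right, map_eq_zero_outer,
      map_sort_left φ f, map_sort_right φ f, Fin.reduceLT, h012, h013, h014, h015, h016,
      h034, h035, h036, h045, h046, h056, h134, h135, h136, h145, h146, h156]
    linarith


/-- Positivity of a 3-form relative to a volume form, tested on independent frames whose last four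
vectors are annihilated by the contraction with the first two. -/
def IsFramePositive (φ : V [⋀^Fin 3]→ₗ[ℝ] ℝ) (D : V [⋀^Fin 7]→ₗ[ℝ] ℝ) : Prop :=
  ∀ f : Fin 7 → V, LinearIndependent ℝ f → φ ![f 0, f 1, f 3] = 0 → φ ![f 0, f 1, f 4] = 0 →
    φ ![f 0, f 1, f 5] = 0 → φ ![f 0, f 1, f 6] = 0 →
    0 < φ ![f 0, f 1, f 2] *
      pfaff (fun x y => φ ![f 0, x, y]) (f 3) (f 4) (f 5) (f 6) * D f

theorem exists_isFlag_of_ne_zero {e : Fin 7 → V} (he : LinearIndependent ℝ e)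
    (h : φ ![e 0, e 1, e 2] ≠ 0) : ∃ f : Fin 7 → V, LinearIndependent ℝ f ∧ IsFlag φ f := by
  obtain ⟨c, hc⟩ : ∃ c : V → ℝ, ∀ x, c x = φ ![e 0, e 1, x] / φ ![e 0, e 1, e 2] :=
    ⟨_, fun _ => rfl⟩
  have hc' : ∀ x, c x * φ ![e 0, e 1, e 2] = φ ![e 0, e 1, x] := fun x => by
    rw [hc, div_mul_cancel₀ _ h]
  refine ⟨![e 0, e 1, (φ ![e 0, e 1, e 2])⁻¹ • e 2, e 3 + (-c (e 3)) • e 2,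
    e 4 + (-c (e 4)) • e 2, e 5 + (-c (e 5)) • e 2, e 6 + (-c (e 6)) • e 2],
    ?_, ⟨?_, ?_, ?_, ?_, ?_⟩⟩
  · rw [Fintype.linearIndependent_iff] at he ⊢
    intro g hg
    have key := he ![g 0, g 1, g 2 * (φ ![e 0, e 1, e 2])⁻¹ - g 3 * c (e 3) - g 4 * c (e 4)
      - g 5 * c (e 5) - g 6 * c (e 6), g 3, g 4, g 5, g 6] (by
        rw [← hg]
        simp only [Fin.sum_univ_seven, Matrix.cons_val]
        module)
    have g0 : g 0 = 0 := key 0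
    have g1 : g 1 = 0 := key 1
    have g3 : g 3 = 0 := key 3
    have g4 : g 4 = 0 := key 4
    have g5 : g 5 = 0 := key 5
    have g6 : g 6 = 0 := key 6
    have g2 : g 2 = 0 := by simpa [g3, g4, g5, g6, h] using key 2
    intro i
    fin_cases i <;> assumption
  all_goals
    simp only [Matrix.cons_val, map_add_third, map_smul_third, neg_mul, hc', add_neg_cancel,
      inv_mul_cancel₀ h]

variable {D : V [⋀^Fin 7]→ₗ[ℝ] ℝ}

theorem IsFramePositive.exists_isFlag (hD : IsFramePositive φ D) {e : Fin 7 → V}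
    (he : LinearIndependent ℝ e) : ∃ f : Fin 7 → V, LinearIndependent ℝ f ∧ IsFlag φ f := by
  by_contra hcon
  have h : ∀ k : Fin 7, 2 ≤ k → φ ![e 0, e 1, e k] = 0 := by
    intro k hk
    by_contra hne
    refine hcon (exists_isFlag_of_ne_zero (he.comp _ (Equiv.swap 2 k).injective) ?_)
    have h0 : Equiv.swap 2 k 0 = 0 := Equiv.swap_apply_of_ne_of_ne (by decide) (by
      rintro rfl; exact absurd hk (by decide))
    have h1 : Equiv.swap 2 k 1 = 1 := Equiv.swap_apply_of_ne_of_ne (by decide) (by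
      rintro rfl; exact absurd hk (by decide))
    simpa only [Function.comp_apply, h0, h1, Equiv.swap_apply_left] using hne
  have := hD e he (h 3 (by decide)) (h 4 (by decide)) (h 5 (by decide)) (h 6 (by decide))
  rw [h 2 le_rfl, zero_mul, zero_mul] at this
  exact lt_irrefl _ this

/-- The polarization of `pfaff`. -/
def pfaffPolar (a b : V → V → ℝ) (x y z w : V) : ℝ :=
  a x y * b z w + a z w * b x y - a x z * b y w - a y w * b x z + a x w * b y z + a y z * b x w

theorem IsFramePositive.pfaff_mul_pos (hD : IsFramePositive φ D) {f : Fin 7 → V}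
    (hf : IsFlag φ f) (hl : LinearIndependent ℝ f) :
    0 < pfaff (fun x y => φ ![f 0, x, y]) (f 3) (f 4) (f 5) (f 6) * D f := by
  simpa [hf.h012] using hD f hl hf.h013 hf.h014 hf.h015 hf.h016

theorem IsFramePositive.pfaff_mul_pos_second (hD : IsFramePositive φ D) {f : Fin 7 → V}
    (hf : IsFlag φ f) (hl : LinearIndependent ℝ f) :
    0 < pfaff (fun x y => φ ![f 1, x, y]) (f 3) (f 4) (f 5) (f 6) * D f := by
  have h := hD (f ∘ Equiv.swap 0 1) (hl.comp _ (Equiv.injective _))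
  rw [D.map_swap _ (by decide)] at h
  have e0 : Equiv.swap (0 : Fin 7) 1 0 = 1 := by decide
  have e1 : Equiv.swap (0 : Fin 7) 1 1 = 0 := by decide
  have e2 : Equiv.swap (0 : Fin 7) 1 2 = 2 := by decide
  have e3 : Equiv.swap (0 : Fin 7) 1 3 = 3 := by decide
  have e4 : Equiv.swap (0 : Fin 7) 1 4 = 4 := by decide
  have e5 : Equiv.swap (0 : Fin 7) 1 5 = 5 := by decide
  have e6 : Equiv.swap (0 : Fin 7) 1 6 = 6 := by decide
  simpa only [Function.comp_apply, e0, e1, e2, e3, e4, e5, e6, map_swap_left φ (f 0) (f 1), hf.h012,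
    hf.h013, hf.h014, hf.h015, hf.h016, neg_zero, neg_mul, one_mul, mul_neg, neg_neg,
    forall_const] using h

theorem IsFramePositive.exists_isFlag_polar_eq_zero (hD : IsFramePositive φ D) {e : Fin 7 → V}
    (he : LinearIndependent ℝ e) (hf : IsFlag φ e) : ∃ f : Fin 7 → V,
      LinearIndependent ℝ f ∧ IsFlag φ f ∧ pfaffPolar (fun x y => φ ![f 0, x, y])
        (fun x y => φ ![f 1, x, y]) (f 3) (f 4) (f 5) (f 6) = 0 := by
  have hp := hD.pfaff_mul_pos hf he
  have hp' := left_ne_zero_of_mul hp.ne'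
  obtain ⟨s, hs⟩ : ∃ s, s * (2 * pfaff (fun x y => φ ![e 0, x, y]) (e 3) (e 4) (e 5) (e 6)) =
    -pfaffPolar (fun x y => φ ![e 0, x, y]) (fun x y => φ ![e 1, x, y]) (e 3) (e 4) (e 5) (e 6) :=
    ⟨_, div_mul_cancel₀ _ (mul_ne_zero two_ne_zero hp')⟩
  have hf' : IsFlag φ ![e 0, e 1 + s • e 0, e 2, e 3, e 4, e 5, e 6] := by
    obtain ⟨h012, h013, h014, h015, h016⟩ := hf
    constructor <;>
      simp only [Matrix.cons_val, map_add_second, map_smul_second, map_eq_zero_left, h012, h013,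
        h014, h015, h016] <;> ring
  refine ⟨_, hf'.linearIndependent ?_, hf', ?_⟩
  · simpa only [Matrix.cons_val] using hp'
  · simp only [pfaffPolar, pfaff, Matrix.cons_val, map_add_first, map_smul_first] at hs ⊢
    linear_combination hs

theorem IsFramePositive.exists_isFlag_pfaff_eq (hD : IsFramePositive φ D) {e : Fin 7 → V}
    (he : LinearIndependent ℝ e) : ∃ f : Fin 7 → V, IsFlag φ f ∧
      pfaff (fun x y => φ ![f 0, x, y]) (f 3) (f 4) (f 5) (f 6) ≠ 0 ∧
      pfaff (fun x y => φ ![f 1, x, y]) (f 3) (f 4) (f 5) (f 6) =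
        pfaff (fun x y => φ ![f 0, x, y]) (f 3) (f 4) (f 5) (f 6) ∧
      pfaffPolar (fun x y => φ ![f 0, x, y])
        (fun x y => φ ![f 1, x, y]) (f 3) (f 4) (f 5) (f 6) = 0 := by
  obtain ⟨f₁, hl₁, hf₁⟩ := hD.exists_isFlag he
  obtain ⟨f, hl, hf, h0⟩ := hD.exists_isFlag_polar_eq_zero hl₁ hf₁
  have hp := hD.pfaff_mul_pos hf hl
  have hq := hD.pfaff_mul_pos_second hf hl
  obtain ⟨p, hp_def⟩ : ∃ p, p = pfaff (fun x y => φ ![f 0, x, y]) (f 3) (f 4) (f 5) (f 6) :=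
    ⟨_, rfl⟩
  obtain ⟨q, hq_def⟩ : ∃ q, q = pfaff (fun x y => φ ![f 1, x, y]) (f 3) (f 4) (f 5) (f 6) :=
    ⟨_, rfl⟩
  rw [← hp_def] at hp
  rw [← hq_def] at hq
  have hpq : 0 < p / q := by
    rw [← mul_div_mul_right p q (right_ne_zero_of_mul hp.ne')]
    exact div_pos hp hq
  have hq0 : q ≠ 0 := left_ne_zero_of_mul hq.ne'
  obtain ⟨r, hr0, hr⟩ : ∃ r : ℝ, r ≠ 0 ∧ r ^ 2 * q = p :=
    ⟨√(p / q), (Real.sqrt_pos.2 hpq).ne', by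
      rw [Real.sq_sqrt hpq.le, div_mul_cancel₀ _ hq0]⟩
  refine ⟨![f 0, r • f 1, r⁻¹ • f 2, f 3, f 4, f 5, f 6], ?_, ?_, ?_, ?_⟩
  · obtain ⟨h012, h013, h014, h015, h016⟩ := hf
    constructor <;>
      simp only [Matrix.cons_val, map_smul_second, map_smul_third, h012, h013,
        h014, h015, h016, mul_zero, mul_one, inv_mul_cancel₀ hr0]
  · simpa only [Matrix.cons_val, ← hp_def] using left_ne_zero_of_mul hp.ne'
  · simp only [Matrix.cons_val, ← hp_def]
    rw [← hr, hq_def]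
    simp only [pfaff, map_smul_first]
    ring
  · simp only [pfaffPolar, Matrix.cons_val, map_smul_first] at h0 ⊢
    linear_combination r * h0

theorem exists_conjugate {u w a b c d : V}
    (hp : pfaff (fun x y => φ ![u, x, y]) a b c d ≠ 0)
    (hq : pfaff (fun x y => φ ![w, x, y]) a b c d = pfaff (fun x y => φ ![u, x, y]) a b c d)
    (h0 : pfaffPolar (fun x y => φ ![u, x, y]) (fun x y => φ ![w, x, y]) a b c d = 0) :
    ∃ a' ∈ Submodule.span ℝ {a, b, c, d}, ∀ x ∈ Submodule.span ℝ {a, b, c, d},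
      φ ![u, a', x] = φ ![w, a, x] ∧ φ ![w, a', x] = -φ ![u, a, x] := by
  obtain ⟨p, hp_def⟩ : ∃ p, p = pfaff (fun x y => φ ![u, x, y]) a b c d := ⟨_, rfl⟩
  rw [← hp_def] at hp hq
  simp only [pfaff, pfaffPolar] at hp_def hq h0
  have ha : a ∈ Submodule.span ℝ {a, b, c, d} := Submodule.subset_span (by simp)
  have hb : b ∈ Submodule.span ℝ {a, b, c, d} := Submodule.subset_span (by simp)
  have hc : c ∈ Submodule.span ℝ {a, b, c, d} := Submodule.subset_span (by simp)
  have hd : d ∈ Submodule.span ℝ {a, b, c, d} := Submodule.subset_span (by simp)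
  have sba := map_swap_right φ
  refine ⟨p⁻¹ • ((φ ![w, a, b] * φ ![u, c, d] - φ ![w, a, c] * φ ![u, b, d]
      + φ ![w, a, d] * φ ![u, b, c]) • a
      + (φ ![w, a, c] * φ ![u, a, d] - φ ![w, a, d] * φ ![u, a, c]) • b
      + (φ ![w, a, d] * φ ![u, a, b] - φ ![w, a, b] * φ ![u, a, d]) • c
      + (φ ![w, a, b] * φ ![u, a, c] - φ ![w, a, c] * φ ![u, a, b]) • d), ?_, ?_⟩
  · exact Submodule.smul_mem _ _ (add_mem (add_mem (add_mem (Submodule.smul_mem _ _ ha)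
      (Submodule.smul_mem _ _ hb)) (Submodule.smul_mem _ _ hc)) (Submodule.smul_mem _ _ hd))
  · intro x hx
    induction hx using Submodule.span_induction with
    | zero =>
      have hz : ∀ y z, φ ![y, z, 0] = 0 := fun y z => φ.map_coord_zero 2 rfl
      simp [hz]
    | add x y _ _ hx hy =>
      simp only [map_add_third φ, hx, hy]
      simp only [neg_add, and_self]
    | smul r x _ hx =>
      rw [map_smul_third, map_smul_third, map_smul_third, map_smul_third, hx.1, hx.2, mul_neg]
      exact ⟨rfl, rfl⟩
    | mem x hx =>
      rcases hx with hx | hx | hx | hx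
      all_goals
        rw [hx]
        simp only [map_smul_second, map_add_second, map_eq_zero_right, sba _ a b, sba _ a c,
          sba _ a d, sba _ b c, sba _ b d, sba _ c d]
        constructor
      all_goals
        rw [inv_mul_eq_iff_eq_mul₀ hp]
      · ring
      · ring
      · linear_combination -φ ![w, a, b] * hp_def
      · linear_combination φ ![w, a, b] * h0 - φ ![u, a, b] * hq
      · linear_combination -φ ![w, a, c] * hp_def
      · linear_combination φ ![w, a, c] * h0 - φ ![u, a, c] * hq
      · linear_combination -φ ![w, a, d] * hp_def
      · linear_combination φ ![w, a, d] * h0 - φ ![u, a, d] * hq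

theorem IsFlag.exists_isComplexFlag_of_ne_zero {f : Fin 7 → V} (hf : IsFlag φ f)
    (hp : pfaff (fun x y => φ ![f 0, x, y]) (f 3) (f 4) (f 5) (f 6) ≠ 0)
    (hq : pfaff (fun x y => φ ![f 1, x, y]) (f 3) (f 4) (f 5) (f 6) =
      pfaff (fun x y => φ ![f 0, x, y]) (f 3) (f 4) (f 5) (f 6))
    (h0 : pfaffPolar (fun x y => φ ![f 0, x, y])
      (fun x y => φ ![f 1, x, y]) (f 3) (f 4) (f 5) (f 6) = 0)
    (hne : φ ![f 0, f 3, f 4] ≠ 0) : ∃ f' : Fin 7 → V, IsComplexFlag φ f' := by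
  obtain ⟨a', ha', hJ⟩ := exists_conjugate hp hq h0
  have hset : ({f 4, f 3, f 6, f 5} : Set V) = {f 3, f 4, f 5, f 6} := by
    ext x; simp only [Set.mem_insert_iff, Set.mem_singleton_iff]; tauto
  have hperm : ∀ k, pfaff (fun x y => φ ![f k, x, y]) (f 4) (f 3) (f 6) (f 5) =
      pfaff (fun x y => φ ![f k, x, y]) (f 3) (f 4) (f 5) (f 6) := fun k => by
    simp only [pfaff, map_sort_right φ f, Fin.reduceLT]; ring
  obtain ⟨b', hb', hK⟩ := exists_conjugate (φ := φ) (u := f 0) (w := f 1)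
    (a := f 4) (b := f 3) (c := f 6) (d := f 5) (by rwa [hperm]) (by rwa [hperm, hperm]) (by
      rw [← h0]
      simp only [pfaffPolar, map_sort_right φ f, Fin.reduceLT]; ring)
  rw [hset] at hb' hK
  have ha : f 3 ∈ Submodule.span ℝ {f 3, f 4, f 5, f 6} := Submodule.subset_span (by simp)
  have hb : f 4 ∈ Submodule.span ℝ {f 3, f 4, f 5, f 6} := Submodule.subset_span (by simp)
  obtain ⟨h012, h013, h014, h015, h016⟩ := hf
  have hs : ∀ x ∈ Submodule.span ℝ {f 3, f 4, f 5, f 6}, φ ![f 0, f 1, x] = 0 := by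
    intro x hx
    induction hx using Submodule.span_induction with
    | zero => exact φ.map_coord_zero 2 rfl
    | add x y _ _ hx hy => rw [map_add_third, hx, hy, add_zero]
    | smul r x _ hx => rw [map_smul_third, hx, mul_zero]
    | mem x hx => rcases hx with rfl | rfl | rfl | rfl <;> assumption
  obtain ⟨l, hl⟩ : ∃ l, l = φ ![f 0, f 3, f 4] := ⟨_, rfl⟩
  obtain ⟨m, hm⟩ : ∃ m, m = φ ![f 1, f 3, f 4] := ⟨_, rfl⟩
  rw [← hl] at hne
  have hN : l ^ 2 + m ^ 2 ≠ 0 := by positivity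
  obtain ⟨α, hα⟩ : ∃ α, α = l / (l ^ 2 + m ^ 2) := ⟨_, rfl⟩
  obtain ⟨β, hβ⟩ : ∃ β, β = m / (l ^ 2 + m ^ 2) := ⟨_, rfl⟩
  have h1 : α * l + β * m = 1 := by rw [hα, hβ]; field_simp
  have h2 : α * m - β * l = 0 := by rw [hα, hβ]; ring
  have sr := map_swap_right φ
  have A33 : φ ![f 0, f 3, a'] = 0 := by rw [sr, (hJ _ ha).1, map_eq_zero_right, neg_zero]
  have B33 : φ ![f 1, f 3, a'] = 0 := by rw [sr, (hJ _ ha).2, map_eq_zero_right, neg_zero, neg_zero]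
  have A44 : φ ![f 0, b', f 4] = 0 := by rw [(hK _ hb).1, map_eq_zero_right]
  have B44 : φ ![f 1, b', f 4] = 0 := by rw [(hK _ hb).2, map_eq_zero_right, neg_zero]
  have A44' : φ ![f 0, f 4, b'] = 0 := by rw [sr, A44, neg_zero]
  have A34' : φ ![f 0, f 3, b'] = m := by rw [sr, (hK _ ha).1, ← sr, hm]
  have B34' : φ ![f 1, f 3, b'] = -l := by rw [sr, (hK _ ha).2, ← sr, hl]
  have A34 : φ ![f 0, a', f 4] = m := by rw [(hJ _ hb).1, hm]
  have B34 : φ ![f 1, a', f 4] = -l := by rw [(hJ _ hb).2, hl]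
  have A3 : φ ![f 0, a', b'] = -l := by rw [(hJ _ hb').1, B34']
  have B3 : φ ![f 1, a', b'] = -m := by rw [(hJ _ hb').2, A34']
  have B44' : φ ![f 1, f 4, b'] = 0 := by rw [sr, B44, neg_zero]
  refine ⟨![f 0, f 1, f 2, f 3, a', α • f 4 + β • b', α • b' + (-β) • f 4],
    ⟨?_, ?_, ?_, ?_, ?_⟩, ?_, ?_, ?_, ?_, ?_, ?_, ?_, ?_, ?_, ?_, ?_, ?_⟩
  all_goals
    simp only [Matrix.cons_val, map_add_second, map_smul_second, map_add_third, map_smul_third,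
      hs _ ha', hs _ hb', h012, h013, h014, map_eq_zero_right, A33, B33, A44, B44, A44', B44',
      A34', B34', A34, B34, A3, B3, ← hl, ← hm]
    try linarith

theorem IsFlag.exists_isComplexFlag {f : Fin 7 → V} (hf : IsFlag φ f)
    (hp : pfaff (fun x y => φ ![f 0, x, y]) (f 3) (f 4) (f 5) (f 6) ≠ 0)
    (hq : pfaff (fun x y => φ ![f 1, x, y]) (f 3) (f 4) (f 5) (f 6) =
      pfaff (fun x y => φ ![f 0, x, y]) (f 3) (f 4) (f 5) (f 6))
    (h0 : pfaffPolar (fun x y => φ ![f 0, x, y])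
      (fun x y => φ ![f 1, x, y]) (f 3) (f 4) (f 5) (f 6) = 0) :
    ∃ f' : Fin 7 → V, IsComplexFlag φ f' := by
  by_cases h34 : φ ![f 0, f 3, f 4] = 0
  · obtain ⟨h012, h013, h014, h015, h016⟩ := hf
    by_cases h35 : φ ![f 0, f 3, f 5] = 0
    · by_cases h36 : φ ![f 0, f 3, f 6] = 0
      · exact absurd (by simp [pfaff, h34, h35, h36]) hp
      · refine IsFlag.exists_isComplexFlag_of_ne_zero (φ := φ)
          (f := ![f 0, f 1, f 2, f 3, f 6, f 4, f 5]) ⟨h012, h013, h016, h014, h015⟩ ?_ ?_ ?_ h36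
        all_goals
          simp only [Matrix.cons_val, pfaff, pfaffPolar, map_sort_right φ f, Fin.reduceLT]
            at hp hq h0 ⊢
        · contrapose! hp
          linear_combination hp
        · linear_combination hq
        · linear_combination h0
    · refine IsFlag.exists_isComplexFlag_of_ne_zero (φ := φ)
        (f := ![f 0, f 1, f 2, f 3, f 5, f 6, f 4]) ⟨h012, h013, h015, h016, h014⟩ ?_ ?_ ?_ h35
      all_goals
        simp only [Matrix.cons_val, pfaff, pfaffPolar, map_sort_right φ f, Fin.reduceLT]
          at hp hq h0 ⊢
      · contrapose! hp
        linear_combination hp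
      · linear_combination hq
      · linear_combination h0
  · exact hf.exists_isComplexFlag_of_ne_zero hp hq h0 h34

theorem IsComplexFlag.pfaff_eq_one {f : Fin 7 → V} (hf : IsComplexFlag φ f) :
    pfaff (fun x y => φ ![f 0, x, y]) (f 3) (f 4) (f 5) (f 6) = 1 := by
  simp [pfaff, hf.h034, hf.h035, hf.h036, hf.h045, hf.h046, hf.h056]

theorem IsComplexFlag.linearIndependent {f : Fin 7 → V} (hf : IsComplexFlag φ f) :
    LinearIndependent ℝ f :=
  hf.toIsFlag.linearIndependent (by rw [hf.pfaff_eq_one]; exact one_ne_zero)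

theorem IsFramePositive.pos_of_isComplexFlag (hD : IsFramePositive φ D) {f : Fin 7 → V}
    (hf : IsComplexFlag φ f) : 0 < D f := by
  simpa [hf.pfaff_eq_one] using hD.pfaff_mul_pos hf.toIsFlag hf.linearIndependent

theorem IsSplitFlag.exists_balanced {f : Fin 7 → V} (hf : IsSplitFlag φ f) :
    ∃ f' : Fin 7 → V, IsSplitFlag φ f' ∧ φ ![f' 2, f' 4, f' 6] = φ ![f' 2, f' 3, f' 5] ∧
      φ ![f' 2, f' 4, f' 5] = -φ ![f' 2, f' 3, f' 6] := by
  obtain ⟨⟨⟨h012, h013, h014, h015, h016⟩, h034, h035, h036, h045, h046, h056,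
    h134, h135, h136, h145, h146, h156⟩, h023, h024, h025, h026, h123, h124, h125, h126,
    h345, h346, h356, h456⟩ := hf
  refine ⟨![f 0, f 1, f 2 + ((φ ![f 2, f 4, f 6] - φ ![f 2, f 3, f 5]) / 2) • f 0
    + ((φ ![f 2, f 3, f 6] + φ ![f 2, f 4, f 5]) / 2) • f 1, f 3, f 4, f 5, f 6], ?_, ?_, ?_⟩
  · repeat' constructor
    all_goals
      simp only [Matrix.cons_val, map_add_second, map_smul_second,
        map_add_third, map_smul_third, map_eq_zero_left, map_eq_zero_right,
        map_sort_left φ f, map_sort_right φ f, Fin.reduceLT, h012, h013, h014, h015, h016,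
        h034, h035, h036, h045, h046, h056, h134, h135, h136, h145, h146, h156,
        h023, h024, h025, h026, h123, h124, h125, h126, h345, h346, h356, h456]
      try ring
  all_goals
    simp only [Matrix.cons_val, map_add_first, map_smul_first, h035, h036, h045, h046,
      h135, h136, h145, h146]
    ring

theorem IsFramePositive.pfaff_two_pos (hD : IsFramePositive φ D) {f : Fin 7 → V}
    (hf : IsSplitFlag φ f) :
    0 < pfaff (fun x y => φ ![f 2, x, y]) (f 3) (f 4) (f 5) (f 6) := by
  have hpos := hD.pos_of_isComplexFlag hf.toIsComplexFlag
  have h := hD (f ∘ (Equiv.swap 0 1 * Equiv.swap 0 2 : Equiv.Perm (Fin 7)))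
    (hf.linearIndependent.comp _ (Equiv.injective _))
  rw [D.map_perm] at h
  have hσ : Equiv.Perm.sign (Equiv.swap 0 1 * Equiv.swap 0 2 : Equiv.Perm (Fin 7)) = 1 := by
    decide
  have he : f ∘ (Equiv.swap 0 1 * Equiv.swap 0 2 : Equiv.Perm (Fin 7)) =
      ![f 2, f 0, f 1, f 3, f 4, f 5, f 6] := by
    ext i; fin_cases i <;> rfl
  rw [hσ, he, one_smul] at h
  simp only [Matrix.cons_val, map_sort_left φ f, map_sort_right φ f, Fin.reduceLT, hf.h012,
    hf.h023, hf.h024, hf.h025, hf.h026, neg_neg, neg_zero, forall_const, one_mul] at h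
  exact (mul_pos_iff_of_pos_right hpos).1 h

theorem IsFramePositive.exists_isDiagonalFlag (hD : IsFramePositive φ D) {e : Fin 7 → V}
    (he : IsSplitFlag φ e) : ∃ f : Fin 7 → V, IsDiagonalFlag φ f := by
  obtain ⟨f, hf, hm, hn⟩ := he.exists_balanced
  have hpf := hD.pfaff_two_pos hf
  simp only [pfaff, hm, hn] at hpf
  have h1 : φ ![f 2, f 3, f 4] ≠ 0 := by
    intro h
    rw [h] at hpf
    nlinarith [sq_nonneg (φ ![f 2, f 3, f 5]), sq_nonneg (φ ![f 2, f 3, f 6])]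
  obtain ⟨y, hy⟩ : ∃ y, y * φ ![f 2, f 3, f 4] = -φ ![f 2, f 3, f 5] := ⟨_, div_mul_cancel₀ _ h1⟩
  obtain ⟨x, hx⟩ : ∃ x, x * φ ![f 2, f 3, f 4] = -φ ![f 2, f 3, f 6] := ⟨_, div_mul_cancel₀ _ h1⟩
  obtain ⟨⟨⟨h012, h013, h014, h015, h016⟩, h034, h035, h036, h045, h046, h056,
    h134, h135, h136, h145, h146, h156⟩, h023, h024, h025, h026, h123, h124, h125, h126,
    h345, h346, h356, h456⟩ := hf
  refine ⟨![f 0, f 1, f 2, f 3, f 4, f 5 + x • f 3 + y • f 4, f 6 + x • f 4 + (-y) • f 3], ?_⟩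
  repeat' constructor
  all_goals
    simp only [Matrix.cons_val, map_add_second, map_smul_second,
      map_add_third, map_smul_third, map_eq_zero_left, map_eq_zero_right, map_eq_zero_outer,
      map_sort_left φ f, map_sort_right φ f, Fin.reduceLT, h012, h013, h014, h015, h016,
      h034, h035, h036, h045, h046, h056, h134, h135, h136, h145, h146, h156,
      h023, h024, h025, h026, h123, h124, h125, h126, h345, h346, h356, h456, hm, hn]
    try linarith

theorem IsFramePositive.diagonal_pos (hD : IsFramePositive φ D) {f : Fin 7 → V}
    (hf : IsDiagonalFlag φ f) : 0 < φ ![f 2, f 3, f 4] ∧ 0 < φ ![f 2, f 5, f 6] := by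
  have hpf := hD.pfaff_two_pos hf.toIsSplitFlag
  have hpos := hD.pos_of_isComplexFlag hf.toIsComplexFlag
  simp only [pfaff, hf.h235, hf.h236, hf.h245, hf.h246, mul_zero, sub_zero, add_zero] at hpf
  let σ : Equiv.Perm (Fin 7) :=
    Equiv.swap 0 1 * Equiv.swap 0 3 * (Equiv.swap 2 4 * Equiv.swap 2 5)
  have h := hD (f ∘ σ) (hf.linearIndependent.comp _ (Equiv.injective _))
  rw [D.map_perm] at h
  have hσ : Equiv.Perm.sign σ = 1 := by decide
  have he : f ∘ σ = ![f 3, f 0, f 5, f 1, f 2, f 4, f 6] := by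
    ext i; fin_cases i <;> rfl
  rw [hσ, he, one_smul] at h
  simp only [pfaff, Matrix.cons_val, map_sort_left φ f, map_sort_right φ f, Fin.reduceLT, hf.h013,
    hf.h023, hf.h034, hf.h035, hf.h036, hf.h123, hf.h134, hf.h136, hf.h236, hf.h346,
    neg_neg, neg_zero, forall_const, one_mul] at h
  have h1 : 0 < φ ![f 2, f 3, f 4] := by
    have := (mul_pos_iff_of_pos_right hpos).1 h
    linarith
  exact ⟨h1, (mul_pos_iff_of_pos_left h1).1 hpf⟩

theorem IsFramePositive.exists_normalized (hD : IsFramePositive φ D) {e : Fin 7 → V}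
    (he : IsDiagonalFlag φ e) : ∃ f : Fin 7 → V, IsDiagonalFlag φ f ∧
      φ ![f 2, f 3, f 4] = 1 ∧ φ ![f 2, f 5, f 6] = 1 := by
  obtain ⟨h1, h2⟩ := hD.diagonal_pos he
  obtain ⟨h, hh⟩ : ∃ h, h = φ ![e 2, e 3, e 4] := ⟨_, rfl⟩
  obtain ⟨k, hk⟩ : ∃ k, k = φ ![e 2, e 5, e 6] := ⟨_, rfl⟩
  rw [← hh] at h1
  rw [← hk] at h2
  obtain ⟨p, hp, hp2⟩ : ∃ p : ℝ, 0 < p ∧ p ^ 2 * h = 1 :=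
    ⟨√h⁻¹, by positivity, by rw [Real.sq_sqrt (by positivity), inv_mul_cancel₀ h1.ne']⟩
  obtain ⟨q, hq, hq2⟩ : ∃ q : ℝ, 0 < q ∧ q ^ 2 * k = 1 :=
    ⟨√k⁻¹, by positivity, by rw [Real.sq_sqrt (by positivity), inv_mul_cancel₀ h2.ne']⟩
  obtain ⟨r, hr, hr3⟩ : ∃ r : ℝ, 0 < r ∧ r ^ 3 * (p * q) = 1 :=
    ⟨((p * q)⁻¹) ^ ((3 : ℕ) : ℝ)⁻¹, by positivity, by
      rw [Real.rpow_inv_natCast_pow (by positivity) three_ne_zero,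
        inv_mul_cancel₀ (by positivity)]⟩
  have hr0 : (r ^ 2)⁻¹ * r ^ 2 = 1 := inv_mul_cancel₀ (by positivity)
  obtain ⟨⟨⟨⟨h012, h013, h014, h015, h016⟩, h034, h035, h036, h045, h046, h056,
    h134, h135, h136, h145, h146, h156⟩, h023, h024, h025, h026, h123, h124, h125, h126,
    h345, h346, h356, h456⟩, h235, h236, h245, h246⟩ := he
  refine ⟨![r • e 0, r • e 1, (r ^ 2)⁻¹ • e 2, (r * p) • e 3, (r * p) • e 4, (r * q) • e 5,
    (r * q) • e 6], ?_, ?_, ?_⟩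
  · repeat' constructor
    all_goals
      simp only [Matrix.cons_val, map_smul_first, map_smul_second, map_smul_third,
        h012, h013, h014, h015, h016,
        h034, h035, h036, h045, h046, h056, h134, h135, h136, h145, h146, h156,
        h023, h024, h025, h026, h123, h124, h125, h126, h345, h346, h356, h456,
        h235, h236, h245, h246, mul_zero]
    all_goals first | linear_combination hr0 | linear_combination hr3 | linear_combination -hr3
  all_goals
    simp only [Matrix.cons_val, map_smul_first, map_smul_second, map_smul_third, ← hh, ← hk]
  · linear_combination p ^ 2 * h * hr0 + hp2
  · linear_combination q ^ 2 * k * hr0 + hq2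

theorem IsFramePositive.exists_isDiagonalFlag_normalized (hD : IsFramePositive φ D)
    {e : Fin 7 → V} (he : LinearIndependent ℝ e) : ∃ f : Fin 7 → V, 0 < D f ∧
      LinearIndependent ℝ f ∧ IsDiagonalFlag φ f ∧
      φ ![f 2, f 3, f 4] = 1 ∧ φ ![f 2, f 5, f 6] = 1 := by
  obtain ⟨f₁, hf₁, hp, hq, h0⟩ := hD.exists_isFlag_pfaff_eq he
  obtain ⟨f₂, hf₂⟩ := hf₁.exists_isComplexFlag hp hq h0
  obtain ⟨f₃, hf₃⟩ := hf₂.exists_isSplitFlag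
  obtain ⟨f₄, hf₄⟩ := hD.exists_isDiagonalFlag hf₃
  obtain ⟨f, hf, h1, h2⟩ := hD.exists_normalized hf₄
  exact ⟨f, hD.pos_of_isComplexFlag hf.toIsComplexFlag, hf.linearIndependent, hf, h1, h2⟩

theorem map_eq_of_sorted {W : Type*} [AddCommGroup W] [Module ℝ W] {ψ : W [⋀^Fin 3]→ₗ[ℝ] ℝ}
    {n : ℕ} {f : Fin n → V} {g : Fin n → W}
    (h : ∀ i j k, i < j → j < k → φ ![f i, f j, f k] = ψ ![g i, g j, g k]) (i j k : Fin n) :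
    φ ![f i, f j, f k] = ψ ![g i, g j, g k] := by
  rcases lt_trichotomy i j with hij | rfl | hij
  · rcases lt_trichotomy j k with hjk | rfl | hjk
    · exact h _ _ _ hij hjk
    · simp only [map_eq_zero_right]
    · rw [map_sort_right φ f _ hjk, map_sort_right ψ g _ hjk]
      rcases lt_trichotomy i k with hik | rfl | hik
      · rw [h _ _ _ hik hjk]
      · simp only [map_eq_zero_left]
      · rw [map_sort_left φ f _ hik, map_sort_left ψ g _ hik, h _ _ _ hik hij]
  · simp only [map_eq_zero_left]
  · rw [map_sort_left φ f _ hij, map_sort_left ψ g _ hij]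
    rcases lt_trichotomy i k with hik | rfl | hik
    · rw [h _ _ _ hij hik]
    · simp only [map_eq_zero_right]
    · rw [map_sort_right φ f _ hik, map_sort_right ψ g _ hik]
      rcases lt_trichotomy j k with hjk | rfl | hjk
      · rw [h _ _ _ hjk hik]
      · simp only [map_eq_zero_left]
      · rw [map_sort_left φ f _ hjk, map_sort_left ψ g _ hjk, h _ _ _ hjk hij]

theorem IsDiagonalFlag.map_eq {W : Type*} [AddCommGroup W] [Module ℝ W]
    {ψ : W [⋀^Fin 3]→ₗ[ℝ] ℝ} {f : Fin 7 → V} {g : Fin 7 → W}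
    (hf : IsDiagonalFlag φ f) (hg : IsDiagonalFlag ψ g)
    (h1 : φ ![f 2, f 3, f 4] = ψ ![g 2, g 3, g 4]) (h2 : φ ![f 2, f 5, f 6] = ψ ![g 2, g 5, g 6])
    (i j k : Fin 7) : φ ![f i, f j, f k] = ψ ![g i, g j, g k] := by
  refine map_eq_of_sorted (fun i j k hij hjk => ?_) i j k
  obtain ⟨⟨⟨⟨h012, h013, h014, h015, h016⟩, h034, h035, h036, h045, h046, h056,
    h134, h135, h136, h145, h146, h156⟩, h023, h024, h025, h026, h123, h124, h125, h126,
    h345, h346, h356, h456⟩, h235, h236, h245, h246⟩ := hf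
  obtain ⟨⟨⟨⟨k012, k013, k014, k015, k016⟩, k034, k035, k036, k045, k046, k056,
    k134, k135, k136, k145, k146, k156⟩, k023, k024, k025, k026, k123, k124, k125, k126,
    k345, k346, k356, k456⟩, k235, k236, k245, k246⟩ := hg
  fin_cases k <;> fin_cases j <;> first | exact absurd hjk (by decide) | skip
  all_goals fin_cases i <;> first | exact absurd hij (by decide) | skip
  all_goals simp only [Fin.reduceFinMk, Fin.zero_eta, Fin.mk_one, *]

end Frames

/-- The frame `∂x₁, ∂y₁, ∂t, ∂x₂, ∂y₂, ∂x₃, ∂y₃` of `ℝ × ℂ³`. -/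
noncomputable def standardFrame : Fin 7 → ℝ × (Fin 3 → ℂ) :=
  ![(0, ![1, 0, 0]), (0, ![Complex.I, 0, 0]), (1, 0), (0, ![0, 1, 0]), (0, ![0, Complex.I, 0]),
    (0, ![0, 0, 1]), (0, ![0, 0, Complex.I])]

theorem phiZero_apply (u v w : ℝ × (Fin 3 → ℂ)) : phiZero ![u, v, w] =
    (∑ j, (Matrix.of ![![(u.2 j).re, (u.2 j).im, u.1], ![(v.2 j).re, (v.2 j).im, v.1],
      ![(w.2 j).re, (w.2 j).im, w.1]]).det) + (Matrix.of ![u.2, v.2, w.2]).det.re := by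
  have h3 : (fun i => (![u, v, w] i).2) = ![u.2, v.2, w.2] := by
    ext i : 1; fin_cases i <;> rfl
  have ht : ∀ j, (fun i => tripCoords j (![u, v, w] i)) = ![![(u.2 j).re, (u.2 j).im, u.1],
      ![(v.2 j).re, (v.2 j).im, v.1], ![(w.2 j).re, (w.2 j).im, w.1]] := fun j => by
    ext i k; fin_cases i <;> fin_cases k <;> rfl
  have h : phiZero ![u, v, w] =
      (∑ j, Matrix.detRowAlternating (R := ℝ) (n := Fin 3) fun i => tripCoords j (![u, v, w] i)) +
      (Matrix.detRowAlternating (R := ℂ) (n := Fin 3) fun i => (![u, v, w] i).2).re := by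
    simp only [phiZero, AlternatingMap.add_apply, Fin.sum_univ_three]
    rfl
  rw [h, h3]
  simp only [ht]
  rfl

theorem isDiagonalFlag_standardFrame : IsDiagonalFlag phiZero standardFrame := by
  repeat' constructor
  all_goals
    simp [standardFrame, phiZero_apply, Matrix.det_fin_three, Fin.sum_univ_three]

theorem phiZero_standardFrame_first :
    phiZero ![standardFrame 2, standardFrame 3, standardFrame 4] = 1 := by
  simp [standardFrame, phiZero_apply, Matrix.det_fin_three, Fin.sum_univ_three]

theorem phiZero_standardFrame_second :
    phiZero ![standardFrame 2, standardFrame 5, standardFrame 6] = 1 := by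
  simp [standardFrame, phiZero_apply, Matrix.det_fin_three, Fin.sum_univ_three]

theorem orientZero_standardFrame : orientZero standardFrame = 1 := by
  let e : Fin 7 → Fin 7 → ℝ := fun i => Pi.single i 1
  let σ : Equiv.Perm (Fin 7) := Equiv.swap 0 1 * Equiv.swap 1 2
  have h : (fun i => realCoords7 (standardFrame i)) = ![e 1, e 2, e 0, e 3, e 4, e 5, e 6] := by
    ext i j
    fin_cases i <;> fin_cases j <;> simp [e, realCoords7, standardFrame]
  have hσ : e ∘ σ = ![e 1, e 2, e 0, e 3, e 4, e 5, e 6] := by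
    ext i : 1
    fin_cases i <;> rfl
  have hsign : Equiv.Perm.sign σ = 1 := by decide
  have he : (Matrix.detRowAlternating (R := ℝ) (n := Fin 7)) e = 1 := by
    have : e = (1 : Matrix (Fin 7) (Fin 7) ℝ) := by
      ext i j
      simp [e, Matrix.one_apply, Pi.single_apply, eq_comm]
    have h1 := Matrix.det_one (n := Fin 7) (R := ℝ)
    rw [← this] at h1
    exact h1
  rw [orientZero, AlternatingMap.compLinearMap_apply, h, ← hσ, AlternatingMap.map_perm, hsign, one_smul, he]

theorem finrank_real_prod_complex : Module.finrank ℝ (ℝ × (Fin 3 → ℂ)) = 7 := by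
  simp [Module.finrank_pi_fintype]

theorem orientZero_ne_zero {f : Fin 7 → ℝ × (Fin 3 → ℂ)} (hf : LinearIndependent ℝ f) :
    orientZero f ≠ 0 := by
  let b := basisOfLinearIndependentOfCardEqFinrank hf
    (by rw [finrank_real_prod_complex, Fintype.card_fin])
  have hb : ⇑b = f := coe_basisOfLinearIndependentOfCardEqFinrank _ _
  rw [← hb, AlternatingMap.map_basis_ne_zero_iff]
  intro h
  have := orientZero_standardFrame
  rw [h] at this
  exact zero_ne_one this

theorem smul_apply_eq_of_wedge_eq {V : Type*} [AddCommGroup V] [Module ℝ V]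
    {φ : V [⋀^Fin 3]→ₗ[ℝ] ℝ} {D : V [⋀^Fin 7]→ₗ[ℝ] ℝ} {c : ℝ} {f : Fin 7 → V}
    (hw : wedge (wedge (φ.curryLeft (f 0)) (φ.curryLeft (f 0))) φ = c • D)
    (h : ∀ i : Fin 4, φ ![f 0, f 1, f i.succ.succ.succ] = 0) :
    c * D f =
      6 * (φ ![f 0, f 1, f 2] * pfaff (fun x y => φ ![f 0, x, y]) (f 3) (f 4) (f 5) (f 6)) := by
  rw [← wedge_contraction_apply φ f h, hw]
  rfl

theorem IsPositive3Form.isFramePositive {φ : (ℝ × (Fin 3 → ℂ)) [⋀^Fin 3]→ₗ[ℝ] ℝ}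
    (hφ : IsPositive3Form φ) : IsFramePositive φ orientZero := by
  intro f hf h3 h4 h5 h6
  obtain ⟨c, hc, h⟩ := hφ (f 0) (hf.ne_zero 0)
  have key := smul_apply_eq_of_wedge_eq h (by
    rw [Fin.forall_fin_succ, Fin.forall_fin_succ, Fin.forall_fin_two]
    exact ⟨h3, h4, h5, h6⟩)
  have := mul_pos hc (mul_self_pos.2 (orientZero_ne_zero hf))
  rw [← mul_assoc, key] at this
  linarith

/-- the positive 3-forms on the oriented 7-dimensional space `ℝ × ℂ³`
form a single orbit of the orientation-preserving general linear group: any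
positive 3-form `φ` is carried to the standard model `φ₀` by an `ℝ`-linear
automorphism of positive determinant. -/
theorem positive3Form_single_orbit
    (φ : (ℝ × (Fin 3 → ℂ)) [⋀^Fin 3]→ₗ[ℝ] ℝ) (hφ : IsPositive3Form φ) :
    ∃ g : (ℝ × (Fin 3 → ℂ)) ≃ₗ[ℝ] (ℝ × (Fin 3 → ℂ)),
      0 < LinearMap.det (g : (ℝ × (Fin 3 → ℂ)) →ₗ[ℝ] (ℝ × (Fin 3 → ℂ))) ∧
      ∀ x y z : ℝ × (Fin 3 → ℂ), φ ![x, y, z] = phiZero ![g x, g y, g z] := by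
  have hcard : Fintype.card (Fin 7) = Module.finrank ℝ (ℝ × (Fin 3 → ℂ)) := by
    rw [finrank_real_prod_complex, Fintype.card_fin]
  have hstd := isDiagonalFlag_standardFrame
  have hli := hstd.linearIndependent
  obtain ⟨f, hpos, hf, hdiag, h1, h2⟩ :=
    hφ.isFramePositive.exists_isDiagonalFlag_normalized hli
  let b := basisOfLinearIndependentOfCardEqFinrank hf hcard
  let b' := basisOfLinearIndependentOfCardEqFinrank hli hcard
  have hb : ⇑b = f := coe_basisOfLinearIndependentOfCardEqFinrank _ _
  have hb' : ⇑b' = standardFrame := coe_basisOfLinearIndependentOfCardEqFinrank _ _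
  let g := b.equiv b' (Equiv.refl _)
  have hg : ∀ i, g (f i) = standardFrame i := fun i => by
    rw [← hb, ← hb']
    simp [g]
  refine ⟨g, ?_, fun x y z => ?_⟩
  · have h := b.det_comp (g : (ℝ × (Fin 3 → ℂ)) →ₗ[ℝ] (ℝ × (Fin 3 → ℂ))) b
    have hcomp : (g : (ℝ × (Fin 3 → ℂ)) →ₗ[ℝ] (ℝ × (Fin 3 → ℂ))) ∘ b = standardFrame := by
      ext1 i
      rw [Function.comp_apply, hb]
      exact hg i
    rw [hcomp, b.det_self, mul_one] at h
    rw [← h]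
    have ho := congrArg (fun ω => ω standardFrame) (orientZero.eq_smul_basis_det b)
    simp only [AlternatingMap.smul_apply, smul_eq_mul, orientZero_standardFrame, hb] at ho
    exact (mul_pos_iff_of_pos_left hpos).1 (ho ▸ one_pos)
  · have h : φ = phiZero.compLinearMap (g : (ℝ × (Fin 3 → ℂ)) →ₗ[ℝ] (ℝ × (Fin 3 → ℂ))) := by
      refine b.ext_alternating fun v _ => ?_
      have key := hdiag.map_eq hstd (h1.trans phiZero_standardFrame_first.symm)
        (h2.trans phiZero_standardFrame_second.symm) (v 0) (v 1) (v 2)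
      simp only [← hg] at key
      rw [AlternatingMap.compLinearMap_apply, hb]
      convert key using 2 <;> ext1 i <;> fin_cases i <;> rfl
    have hv : ![g x, g y, g z] = fun i => g (![x, y, z] i) := by
      ext1 i
      fin_cases i <;> rfl
    rw [hv, h]
    rfl
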